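/- Let Γ be a canonical signed unicyclic graph with girth g whose unique cycle C has length g, and suppose Γ is not itself a cycle. Let v_1, …, v_k (k ≥ 1) be the major vertices of Γ listed in cyclic order along C, and let l_1, …, l_k ≥ 0 be the numbers of vertices on the k arcs of C strictly between consecutive major vertices. Then g = k + l_1 + ⋯ + l_k and i_-(Γ) = k + ⌊l_1/2⌋ + ⌊l_2/2⌋ + ⋯ + ⌊l_k/2⌋. -/

import Mathlib

/-- The negative inertia index of a real symmetric matrix: the number of negative
eigenvalues counted with multiplicity. -/
noncomputable def negInertia {n : Type} [Fintype n] [DecidableEq n]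
    {A : Matrix n n ℝ} (hA : A.IsHermitian) : ℕ :=
  (Finset.univ.filter fun i => hA.eigenvalues i < 0).card

open Matrix in
lemma card_le_of_cover {V ι : Type} [Fintype V] [DecidableEq V] [Fintype ι]
    {A : Matrix V V ℝ} (hA : A.IsHermitian) (c : ι → V)
    (hcov : ∀ u v, A u v ≠ 0 → u ∈ Set.range c ∨ v ∈ Set.range c)
    (s : ℝ) (J : Finset V) (hJ : ∀ j ∈ J, 0 < s * hA.eigenvalues j) :
    J.card ≤ Fintype.card ι := by
  classical
  by_contra! hlt
  let u : V → V → ℝ := fun j => ⇑(hA.eigenvectorBasis j)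
  have hu : ∀ j, A *ᵥ u j = hA.eigenvalues j • u j := hA.mulVec_eigenvectorBasis
  have horth : ∀ i j, u i ⬝ᵥ u j = if i = j then 1 else 0 := by
    intro i j
    have := (orthonormal_iff_ite.1 hA.eigenvectorBasis.orthonormal) i j
    rw [← this, EuclideanSpace.inner_eq_star_dotProduct, dotProduct_comm]
    simp [u]
  let F : (J → ℝ) →ₗ[ℝ] (ι → ℝ) :=
    { toFun := fun α i => ∑ j : J, α j * u j (c i)
      map_add' := by intro x y; ext i; simp [add_mul, Finset.sum_add_distrib]
      map_smul' := by intro r x; ext i; simp [mul_assoc, Finset.mul_sum] }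
  have hker : LinearMap.ker F ≠ ⊥ := by
    apply LinearMap.ker_ne_bot_of_finrank_lt
    simpa using hlt
  obtain ⟨α, hα, hα0⟩ := (Submodule.ne_bot_iff _).1 hker
  let x : V → ℝ := ∑ j : J, α j • u j
  have hx : ∀ i, x (c i) = 0 := by
    intro i
    have := congrFun (LinearMap.mem_ker.1 hα) i
    simpa [F, x, Finset.sum_apply] using this
  have h0 : x ⬝ᵥ A *ᵥ x = 0 := by
    simp only [dotProduct, mulVec, Finset.mul_sum]
    refine Finset.sum_eq_zero fun p _ => Finset.sum_eq_zero fun q _ => ?_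
    by_cases h : A p q = 0
    · simp [h]
    · rcases hcov p q h with ⟨i, rfl⟩ | ⟨i, rfl⟩ <;> simp [hx]
  have h1 : x ⬝ᵥ A *ᵥ x = ∑ j : J, hA.eigenvalues j * α j ^ 2 := by
    simp only [x, mulVec_sum, mulVec_smul, hu, sum_dotProduct, dotProduct_sum, smul_dotProduct,
      dotProduct_smul, horth, smul_eq_mul]
    refine Finset.sum_congr rfl fun j _ => ?_
    rw [Finset.sum_eq_single j]
    · simp; ring
    · intro b _ hb
      have : (b : V) ≠ j := fun h => hb (Subtype.ext h)
      rw [if_neg this]; simp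
    · simp
  have h2 : 0 < s * ∑ j : J, hA.eigenvalues j * α j ^ 2 := by
    rw [Finset.mul_sum]
    obtain ⟨j, hj⟩ := Function.ne_iff.1 hα0
    refine Finset.sum_pos' (fun i _ => ?_) ⟨j, Finset.mem_univ _, ?_⟩
    · rw [← mul_assoc]; exact mul_nonneg (hJ i i.2).le (sq_nonneg _)
    · rw [← mul_assoc]
      have : α j ≠ 0 := hj
      exact mul_pos (hJ j j.2) (by positivity)
  rw [← h1, h0] at h2
  simp at h2

open Matrix in
lemma negInertia_eq_card {V ι : Type} [Fintype V] [DecidableEq V] [Fintype ι]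
    {A : Matrix V V ℝ} (hA : A.IsHermitian) (c m : ι → V) (r : ι → ℕ)
    (hcov : ∀ u v, A u v ≠ 0 → u ∈ Set.range c ∨ v ∈ Set.range c)
    (hm : ∀ i, m i ∉ Set.range c)
    (hdiag : ∀ i, A (c i) (m i) ≠ 0)
    (htri : ∀ i j, A (c i) (m j) ≠ 0 → i = j ∨ r i < r j) :
    negInertia hA = Fintype.card ι := by
  classical
  have hsymm : ∀ u v, A u v = A v u := fun u v => by
    have := hA.apply u v
    simpa using this.symm
  have hneg : (Finset.univ.filter fun i => hA.eigenvalues i < 0).card ≤ Fintype.card ι :=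
    card_le_of_cover hA c hcov (-1) _ (by intro j hj; simpa using hj)
  have hpos : (Finset.univ.filter fun i => 0 < hA.eigenvalues i).card ≤ Fintype.card ι :=
    card_le_of_cover hA c hcov 1 _ (by intro j hj; simpa using hj)
  let M : Matrix ι ι ℝ := A.submatrix c m
  have hMinj : ∀ y : ι → ℝ, y ᵥ* M = 0 → y = 0 := by
    intro y hy
    have key : ∀ n, ∀ j, r j = n → y j = 0 := by
      intro n
      induction n using Nat.strong_induction_on with
      | _ n ih =>
        intro j hj
        have h := congrFun hy j
        simp only [vecMul, dotProduct, Pi.zero_apply] at h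
        rw [Finset.sum_eq_single j] at h
        · exact (mul_eq_zero.1 h).resolve_right (hdiag j)
        · intro i _ hij
          by_cases hz : A (c i) (m j) = 0
          · simp [M, hz]
          · have := (htri i j hz).resolve_left hij
            rw [ih (r i) (hj ▸ this) i rfl, zero_mul]
        · simp
    exact funext fun j => key _ j rfl
  have hMu : IsUnit M := by
    rw [← vecMul_injective_iff_isUnit]
    intro y z hyz
    have : (y - z) ᵥ* M = 0 := by rw [sub_vecMul]; exact sub_eq_zero.2 hyz
    exact sub_eq_zero.1 (hMinj _ this)
  have hMinj2 : ∀ z : ι → ℝ, M *ᵥ z = 0 → z = 0 := by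
    intro z hz
    exact mulVec_injective_iff_isUnit.2 hMu (by simpa using hz)
  let S : Matrix (ι ⊕ ι) (ι ⊕ ι) ℝ := A.submatrix (Sum.elim c m) (Sum.elim c m)
  have hS : S = fromBlocks (A.submatrix c c) M Mᵀ 0 := by
    ext (i | i) (j | j)
    · rfl
    · rfl
    · exact hsymm _ _
    · simp only [S, submatrix_apply, Sum.elim_inr, fromBlocks_apply₂₂, Matrix.zero_apply]
      by_contra h
      rcases hcov _ _ h with h | h <;> exact hm _ h
  have hSu : IsUnit S := by
    rw [← mulVec_injective_iff_isUnit]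
    suffices ∀ w, S *ᵥ w = 0 → w = 0 by
      intro y z hyz
      exact sub_eq_zero.1 (this _ (by rw [mulVec_sub]; exact sub_eq_zero.2 hyz))
    intro w hw
    rw [hS, fromBlocks_mulVec] at hw
    have e1 : A.submatrix c c *ᵥ (w ∘ Sum.inl) + M *ᵥ (w ∘ Sum.inr) = 0 :=
      funext fun i => congrFun hw (Sum.inl i)
    have e2 : Mᵀ *ᵥ (w ∘ Sum.inl) = 0 := by
      have : Mᵀ *ᵥ (w ∘ Sum.inl) + 0 *ᵥ (w ∘ Sum.inr) = 0 :=
        funext fun i => congrFun hw (Sum.inr i)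
      simpa using this
    rw [mulVec_transpose] at e2
    have y0 := hMinj _ e2
    rw [y0, mulVec_zero, zero_add] at e1
    have z0 := hMinj2 _ e1
    ext (i | i)
    · exact congrFun y0 i
    · exact congrFun z0 i
  have hrank : 2 * Fintype.card ι ≤ A.rank := by
    have h1 := rank_of_isUnit S hSu
    have h2 := rank_submatrix_le A (Sum.elim c m) (Sum.elim c m)
    change S.rank ≤ _ at h2
    rw [h1, Fintype.card_sum] at h2
    omega
  rw [hA.rank_eq_card_non_zero_eigs, Fintype.card_subtype] at hrank
  have hsub : (Finset.univ.filter fun i => hA.eigenvalues i ≠ 0).card ≤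
      (Finset.univ.filter fun i => hA.eigenvalues i < 0).card +
      (Finset.univ.filter fun i => 0 < hA.eigenvalues i).card := by
    rw [← Finset.card_union_of_disjoint]
    · apply Finset.card_le_card
      intro i hi
      simp only [Finset.mem_union, Finset.mem_filter, Finset.mem_univ, true_and] at hi ⊢
      exact lt_or_gt_of_ne hi
    · rw [Finset.disjoint_filter]
      intro i _ h1 h2
      linarith
  unfold negInertia
  omega

lemma chordless {V : Type} (G : SimpleGraph V) (g : ℕ) [NeZero g] (hg : G.girth = g)
    (f : ZMod g → V) (hfinj : Function.Injective f)
    (hcyc : ∀ m : ZMod g, G.Adj (f m) (f (m + 1))) (m n : ZMod g) (h : G.Adj (f m) (f n)) :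
    n = m + 1 ∨ m = n + 1 := by
  have walk : ∀ d : ℕ, d < g → ∃ p : G.Walk (f m) (f (m + d)), p.length = d ∧ p.IsPath ∧
      (∀ v ∈ p.support, ∃ j : ℕ, j ≤ d ∧ v = f (m + j)) ∧
      (∀ e ∈ p.edges, ∃ q, e = s(f q, f (q + 1))) := by
    intro d
    induction d with
    | zero =>
      intro _
      refine ⟨(SimpleGraph.Walk.nil : G.Walk (f m) (f m)).copy rfl (by simp), ?_, ?_, ?_, ?_⟩
      · simp
      · simp
      · intro v hv
        exact ⟨0, le_rfl, by simpa using hv⟩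
      · simp
    | succ d ih =>
      intro hd
      obtain ⟨p, h1, h2, h3, h4⟩ := ih (by omega)
      have e : m + (d : ZMod g) + 1 = m + ((d + 1 : ℕ) : ZMod g) := by push_cast; ring
      refine ⟨(p.concat (hcyc (m + d))).copy rfl (by rw [e]), ?_, ?_, ?_, ?_⟩
      · simp [h1]
      · rw [SimpleGraph.Walk.isPath_copy, SimpleGraph.Walk.concat_isPath_iff]
        refine ⟨h2, fun hmem => ?_⟩
        obtain ⟨j, hj, hje⟩ := h3 _ hmem
        have := hfinj hje
        rw [e] at this
        have := add_left_cancel this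
        rw [ZMod.natCast_eq_natCast_iff', Nat.mod_eq_of_lt hd, Nat.mod_eq_of_lt (by omega)] at this
        omega
      · intro v hv
        simp only [SimpleGraph.Walk.support_copy, SimpleGraph.Walk.support_concat,
          List.concat_eq_append, List.mem_append, List.mem_singleton] at hv
        rcases hv with hv | hv
        · obtain ⟨j, hj, hje⟩ := h3 _ hv
          exact ⟨j, by omega, hje⟩
        · exact ⟨d + 1, le_rfl, by rw [hv, e]⟩
      · intro v hv
        simp only [SimpleGraph.Walk.edges_copy, SimpleGraph.Walk.edges_concat,
          List.concat_eq_append, List.mem_append, List.mem_singleton] at hv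
        rcases hv with hv | hv
        · exact h4 _ hv
        · exact ⟨_, hv⟩
  set d := (n - m).val with hd
  have hdg : d < g := ZMod.val_lt _
  have hdn : m + (d : ZMod g) = n := by rw [hd, ZMod.natCast_zmod_val]; ring
  obtain ⟨p, h1, h2, -, h4⟩ := walk d hdg
  by_contra! hcon
  have hadj : G.Adj (f (m + d)) (f m) := by rw [hdn]; exact h.symm
  have hcycle : (SimpleGraph.Walk.cons hadj p).IsCycle := by
    rw [SimpleGraph.Walk.cons_isCycle_iff]
    refine ⟨h2, fun he => ?_⟩
    obtain ⟨q, hq⟩ := h4 _ he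
    rw [hdn, Sym2.eq_iff] at hq
    rcases hq with ⟨e1, e2⟩ | ⟨e1, e2⟩
    · have e1 := hfinj e1
      have e2 := hfinj e2
      exact hcon.2 (by rw [e2, e1])
    · have e1 := hfinj e1
      have e2 := hfinj e2
      exact hcon.1 (by rw [e2, e1])
  have hle := SimpleGraph.girth_le_length hcycle
  rw [SimpleGraph.Walk.length_cons, h1, hg] at hle
  have hd1 : d + 1 = g := by omega
  apply hcon.2
  rw [← hdn, add_assoc]
  have : ((d + 1 : ℕ) : ZMod g) = 0 := by rw [hd1]; simp
  push_cast at this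
  rw [this, add_zero]

/-- For a canonical signed unicyclic graph `Γ` (adjacency matrix `A` over
the underlying graph `G`) with girth `g`, whose unique cycle is parametrized by
`f : ZMod g → V`, which is not itself a cycle, with major vertices at positions
`a 0 < a 1 < ⋯ < a (k-1)` along the cycle and `l i` vertices strictly between
consecutive major vertices: `g = k + ∑ l i` and `i₋(Γ) = k + ∑ ⌊l i / 2⌋`. -/
theorem stmt_3 {V : Type} [Fintype V] [DecidableEq V]
    (G : SimpleGraph V) (A : Matrix V V ℝ) (hA : A.IsHermitian)
    (hone : ∀ u v, G.Adj u v → A u v = 1 ∨ A u v = -1)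
    (hzero : ∀ u v, ¬ G.Adj u v → A u v = 0)
    (g : ℕ) (hgirth : G.girth = (g : ℕ∞))
    (f : ZMod g → V) (hfinj : Function.Injective f)
    (hcyc : ∀ m : ZMod g, G.Adj (f m) (f (m + 1)))
    (hpend : ∀ v, v ∉ Set.range f → ∃! u, u ∈ Set.range f ∧ G.Adj v u)
    (hind : ∀ v w, v ∉ Set.range f → w ∉ Set.range f → ¬ G.Adj v w)
    (hnotcycle : ∃ v, v ∉ Set.range f)
    (k : ℕ) (hk : 1 ≤ k)
    (a : Fin k → ℕ) (ha : StrictMono a) (halt : ∀ i, a i < g)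
    (hmaj : ∀ m : ZMod g,
      ((∃ w, w ∉ Set.range f ∧ G.Adj (f m) w) ↔ ∃ i : Fin k, m = (a i : ZMod g)))
    (l : Fin k → ℕ)
    (hl : ∀ i : Fin k, ∀ h : (i : ℕ) + 1 < k, a ⟨(i : ℕ) + 1, h⟩ = a i + l i + 1)
    (hlast : g + a ⟨0, by omega⟩ = a ⟨k - 1, by omega⟩ + l ⟨k - 1, by omega⟩ + 1) :
    g = k + (∑ i, l i) ∧ negInertia hA = k + ∑ i, l i / 2 := by
  have hgpos : 0 < g := lt_of_le_of_lt (Nat.zero_le _) (halt ⟨0, by omega⟩)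
  haveI : NeZero g := ⟨hgpos.ne'⟩
  have hg : G.girth = g := by exact_mod_cast hgirth
  -- the length of the cycle
  have hsum : g = k + ∑ i, l i := by
    let b : ℕ → ℕ := fun n => if h : n < k then l ⟨n, h⟩ else 0
    have hb : ∀ i : Fin k, l i = b i := fun i => by simp [b]
    have hbs : ∑ i, l i = ∑ n ∈ Finset.range k, b n := by
      rw [← Fin.sum_univ_eq_sum_range]
      exact Finset.sum_congr rfl fun i _ => hb i
    have tele : ∀ n (h : n < k), a ⟨n, h⟩ = a ⟨0, by omega⟩ + n + ∑ j ∈ Finset.range n, b j := by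
      intro n
      induction n with
      | zero => intro h; simp
      | succ n ih =>
        intro h
        have h1 := hl ⟨n, by omega⟩ h
        have h2 := ih (by omega)
        have h3 := hb ⟨n, by omega⟩
        simp only at h1 h3
        rw [Finset.sum_range_succ, ← h3, h1, h2]
        ring
    have h1 := tele (k - 1) (by omega)
    have h2 := hb ⟨k - 1, by omega⟩
    simp only at h2
    have h3 : ∑ n ∈ Finset.range k, b n = ∑ n ∈ Finset.range (k - 1), b n + b (k - 1) := by
      rw [← Finset.sum_range_succ]
      congr 2
      omega
    rw [hbs, h3]
    omega
  refine ⟨hsum, ?_⟩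
  -- the end of an arc is followed by a major vertex
  have hend : ∀ i, ∃ i', (a i : ZMod g) + (l i : ℕ) + 1 = a i' := by
    intro i
    by_cases h : (i : ℕ) + 1 < k
    · refine ⟨⟨i + 1, h⟩, ?_⟩
      rw [hl i h]
      push_cast
      ring
    · refine ⟨⟨0, by omega⟩, ?_⟩
      have hi : i = ⟨k - 1, by omega⟩ := Fin.ext (by simp; omega)
      have := congrArg (Nat.cast : ℕ → ZMod g) hlast
      push_cast at this
      rw [← hi] at this
      rw [← this]
      simp
  let φ : (Σ i : Fin k, Fin (l i + 1)) → ZMod g := fun p => (a p.1 : ZMod g) + ((p.2 : ℕ) : ZMod g)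
  have hφstep : ∀ q, q ∈ Set.range φ → q + 1 ∈ Set.range φ := by
    rintro _ ⟨⟨i, t⟩, rfl⟩
    by_cases h : (t : ℕ) = l i
    · obtain ⟨i', hi'⟩ := hend i
      refine ⟨⟨i', 0⟩, ?_⟩
      simp only [φ]
      rw [h, hi']
      simp
    · refine ⟨⟨i, ⟨t + 1, by omega⟩⟩, ?_⟩
      simp only [φ]
      push_cast
      ring
  have hφsurj : Function.Surjective φ := by
    have key : ∀ n : ℕ, φ ⟨⟨0, by omega⟩, 0⟩ + (n : ZMod g) ∈ Set.range φ := by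
      intro n
      induction n with
      | zero => exact ⟨⟨⟨0, by omega⟩, 0⟩, by simp⟩
      | succ n ih =>
        have := hφstep _ ih
        push_cast
        rwa [← add_assoc]
    intro q
    have := key (q - φ ⟨⟨0, by omega⟩, 0⟩).val
    rwa [ZMod.natCast_zmod_val, add_sub_cancel] at this
  have hφinj : Function.Injective φ := by
    refine ((Fintype.bijective_iff_surjective_and_card φ).2 ⟨hφsurj, ?_⟩).1
    rw [ZMod.card, Fintype.card_sigma]
    simp only [Fintype.card_fin, Finset.sum_add_distrib, Finset.sum_const, Finset.card_univ,
      smul_eq_mul, mul_one]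
    omega
  have huniq : ∀ (i i' : Fin k) (t t' : ℕ), t ≤ l i → t' ≤ l i' →
      (a i : ZMod g) + (t : ZMod g) = a i' + (t' : ZMod g) → i = i' ∧ t = t' := by
    intro i i' t t' ht ht' h
    have := @hφinj ⟨i, ⟨t, by omega⟩⟩ ⟨i', ⟨t', by omega⟩⟩ h
    rw [Sigma.mk.injEq] at this
    obtain ⟨rfl, h2⟩ := this
    exact ⟨rfl, by simpa using h2⟩
  have hadj : ∀ u v, A u v ≠ 0 → G.Adj u v := fun u v h => by
    by_contra h'
    exact h (hzero u v h')
  have hne : ∀ u v, G.Adj u v → A u v ≠ 0 := fun u v h => by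
    rcases hone u v h with h | h <;> rw [h] <;> norm_num
  have hpen : ∀ i : Fin k, ∃ w, w ∉ Set.range f ∧ G.Adj (f (a i)) w :=
    fun i => (hmaj _).2 ⟨i, rfl⟩
  choose w hw hwadj using hpen
  let c : (Σ i : Fin k, Fin (l i / 2 + 1)) → V :=
    fun p => f ((a p.1 : ZMod g) + ((2 * (p.2 : ℕ) : ℕ) : ZMod g))
  let m : (Σ i : Fin k, Fin (l i / 2 + 1)) → V :=
    fun p => if (p.2 : ℕ) = 0 then w p.1 else
      f ((a p.1 : ZMod g) + ((2 * (p.2 : ℕ) - 1 : ℕ) : ZMod g))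
  have hcmaj : ∀ i, f (a i) ∈ Set.range c := fun i => ⟨⟨i, 0⟩, by simp [c]⟩
  have hcedge : ∀ q, f q ∈ Set.range c ∨ f (q + 1) ∈ Set.range c := by
    intro q
    obtain ⟨⟨i, ⟨t, ht⟩⟩, rfl⟩ := hφsurj q
    rcases Nat.even_or_odd' t with ⟨s, rfl | rfl⟩
    · left
      exact ⟨⟨i, ⟨s, by omega⟩⟩, rfl⟩
    · right
      by_cases h : 2 * s + 1 = l i
      · obtain ⟨i', hi'⟩ := hend i
        simp only [φ]
        rw [h, hi']
        exact hcmaj i'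
      · refine ⟨⟨i, ⟨s + 1, by omega⟩⟩, ?_⟩
        simp only [φ, c]
        congr 1
        push_cast
        ring
  have hcout : ∀ u v, G.Adj u v → u ∉ Set.range f → v ∈ Set.range c := by
    intro u v h hu
    have hv : v ∈ Set.range f := by
      by_contra hv
      exact hind u v hu hv h
    obtain ⟨q, rfl⟩ := hv
    obtain ⟨i, rfl⟩ := (hmaj q).1 ⟨u, hu, h.symm⟩
    exact hcmaj i
  have main := negInertia_eq_card hA c m (fun p => (p.2 : ℕ)) ?_ ?_ ?_ ?_
  · rw [main, Fintype.card_sigma]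
    simp only [Fintype.card_fin, Finset.sum_add_distrib, Finset.sum_const, Finset.card_univ,
      smul_eq_mul, mul_one]
    omega
  · intro u v huv
    have h := hadj u v huv
    by_cases hu : u ∈ Set.range f
    · by_cases hv : v ∈ Set.range f
      · obtain ⟨p, rfl⟩ := hu
        obtain ⟨q, rfl⟩ := hv
        rcases chordless G g hg f hfinj hcyc p q h with rfl | rfl
        · exact hcedge p
        · exact (hcedge q).symm
      · exact Or.inl (hcout v u h.symm hv)
    · exact Or.inr (hcout u v h hu)
  · rintro ⟨i, ⟨j, hj⟩⟩ ⟨⟨i', ⟨j', hj'⟩⟩, h⟩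
    simp only [m, c] at h
    split_ifs at h with h0
    · exact hw i ⟨_, h⟩
    · have := huniq i' i _ _ (by omega) (by omega) (hfinj h)
      omega
  · rintro ⟨i, ⟨j, hj⟩⟩
    apply hne
    simp only [m, c]
    split_ifs with h0
    · subst h0
      simpa using hwadj i
    · have := (hcyc ((a i : ZMod g) + ((2 * j - 1 : ℕ) : ZMod g))).symm
      have e : (a i : ZMod g) + ((2 * j - 1 : ℕ) : ZMod g) + 1
          = (a i : ZMod g) + ((2 * j : ℕ) : ZMod g) := by
        rw [add_assoc, ← Nat.cast_add_one]
        congr 2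
        omega
      rwa [e] at this
  · rintro ⟨i, ⟨j, hj⟩⟩ ⟨i', ⟨j', hj'⟩⟩ h
    have h := hadj _ _ h
    simp only [m, c] at h
    split_ifs at h with h0
    · left
      obtain ⟨u, -, hu⟩ := hpend (w i') (hw i')
      have e1 := hu _ ⟨⟨_, rfl⟩, h.symm⟩
      have e2 := hu _ ⟨⟨_, rfl⟩, (hwadj i').symm⟩
      have e3 := hfinj (e1.trans e2.symm)
      obtain ⟨rfl, e4⟩ := huniq i i' (2 * j) 0 (by omega) (by omega) (by simpa using e3)
      have : j = j' := by omega
      subst this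
      rfl
    · have e : (a i' : ZMod g) + ((2 * j' - 1 : ℕ) : ZMod g) + 1
          = (a i' : ZMod g) + ((2 * j' : ℕ) : ZMod g) := by
        rw [add_assoc, ← Nat.cast_add_one]
        congr 2
        omega
      have e' : (a i' : ZMod g) + ((2 * j' - 1 : ℕ) : ZMod g)
          = (a i' : ZMod g) + ((2 * j' - 2 : ℕ) : ZMod g) + 1 := by
        rw [add_assoc, ← Nat.cast_add_one]
        congr 2
        omega
      rcases chordless G g hg f hfinj hcyc _ _ h with h | h
      · right
        rw [e'] at h
        obtain ⟨-, h2⟩ := huniq _ _ _ _ (by omega) (by omega) (add_right_cancel h)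
        simp only
        omega
      · left
        rw [e] at h
        obtain ⟨rfl, h2⟩ := huniq _ _ _ _ (by omega) (by omega) h
        have : j = j' := by omega
        subst this
        rfl
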